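/- For a finitely generated commutative semigroup S, the following are equivalent: (1) the semigroup of all endomorphisms of S under pointwise multiplication is a free commutative semigroup (on some set); (2) the semigroup of all endomorphisms of S under pointwise multiplication is an infinite monogenic semigroup generated by the identity endomorphism, i.e., every endomorphism of S has the form x ↦ x^n for some positive integer n, and the endomorphisms x ↦ x^n for distinct positive integers n are pairwise distinct. -/

import Mathlib

/-- `spow x n` is the `(n+1)`-st power `x^(n+1)` of `x` in a semigroup. -/
def spow {S : Type*} [Semigroup S] (x : S) : ℕ → S
  | 0 => x
  | n + 1 => spow x n * x

/-- The endomorphisms of a semigroup `S`. -/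
def SemigroupEnd (S : Type*) [Semigroup S] : Type _ :=
  {f : S → S // ∀ x y : S, f (x * y) = f x * f y}

/-- The endomorphisms of a commutative semigroup form a commutative semigroup
under pointwise multiplication. -/
instance (S : Type*) [CommSemigroup S] : CommSemigroup (SemigroupEnd S) where
  mul f g := ⟨fun x => f.1 x * g.1 x, fun x y => by
    simp only
    rw [f.2, g.2, mul_mul_mul_comm]⟩
  mul_assoc f g h := Subtype.ext (funext fun x => mul_assoc _ _ _)
  mul_comm f g := Subtype.ext (funext fun x => mul_comm _ _)

/-- The free commutative semigroup on `X`: nonzero finite multisets over `X`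
under addition (written multiplicatively). -/
def FreeCommSemigroup (X : Type*) : Type _ := {m : Multiset X // m ≠ 0}

instance (X : Type*) : CommSemigroup (FreeCommSemigroup X) where
  mul a b := ⟨a.1 + b.1, by
    intro h
    apply a.2
    have hc := congrArg Multiset.card h
    rw [Multiset.card_add] at hc
    simp only [Multiset.card_zero, Nat.add_eq_zero] at hc
    exact Multiset.card_eq_zero.mp hc.1⟩
  mul_assoc a b c := Subtype.ext (add_assoc a.1 b.1 c.1)
  mul_comm a b := Subtype.ext (add_comm a.1 b.1)

/-- **Farkas' lemma** for finitely many linear functionals on a rational vector space. -/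
theorem exists_nonneg_combination_of_forall_nonneg {W ι : Type*} [AddCommGroup W] [Module ℚ W]
    [DecidableEq ι] (s : Finset ι) (α : ι → W →ₗ[ℚ] ℚ) (γ : W →ₗ[ℚ] ℚ)
    (h : ∀ x, (∀ i ∈ s, 0 ≤ α i x) → 0 ≤ γ x) :
    ∃ c : ι → ℚ, (∀ i, 0 ≤ c i) ∧ ∀ x, γ x = ∑ i ∈ s, c i * α i x := by
  induction s using Finset.induction_on generalizing α γ with
  | empty =>
    refine ⟨fun _ => 0, fun _ => le_rfl, fun x => ?_⟩
    have h₁ := h x (by simp)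
    have h₂ := h (-x) (by simp)
    rw [map_neg] at h₂
    simp only [Finset.sum_empty]
    linarith
  | insert j s hj ih =>
    by_cases hs : ∀ x, (∀ i ∈ s, 0 ≤ α i x) → 0 ≤ γ x
    · obtain ⟨c, hc, hγ⟩ := ih α γ hs
      refine ⟨Function.update c j 0, fun i => ?_, fun x => ?_⟩
      · by_cases hij : i = j
        · simp [hij]
        · simpa [hij] using hc i
      · rw [Finset.sum_insert hj, hγ x, Function.update_self, zero_mul, zero_add]
        refine Finset.sum_congr rfl fun i hi => ?_
        rw [Function.update_of_ne (ne_of_mem_of_not_mem hi hj)]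
    · push Not at hs
      obtain ⟨x₀, hx₀, hγ₀⟩ := hs
      have hj₀ : α j x₀ < 0 := by
        by_contra! hc
        exact absurd (h x₀ (by simpa [hc] using hx₀)) (not_le.mpr hγ₀)
      set a : ℚ := -(α j x₀)⁻¹ with ha
      have ha₀ : 0 < a := by rw [ha]; exact neg_pos.mpr (inv_lt_zero.mpr hj₀)
      have haj : a * α j x₀ = -1 := by rw [ha, neg_mul, inv_mul_cancel₀ hj₀.ne]
      obtain ⟨c, hc, hγ⟩ := ih (fun i => α i + (a * α i x₀) • α j) (γ + (a * γ x₀) • α j)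
        (fun x hx => by
          have key := h (x + (a * α j x) • x₀) (fun i hi => by
            rw [map_add, map_smul, smul_eq_mul]
            rcases Finset.mem_insert.mp hi with rfl | hi
            · linear_combination (-α i x) * haj
            · have := hx i hi
              simp only [LinearMap.add_apply, LinearMap.smul_apply, smul_eq_mul] at this
              linarith)
          rw [map_add, map_smul, smul_eq_mul] at key
          simp only [LinearMap.add_apply, LinearMap.smul_apply, smul_eq_mul]
          linarith)
      have hsum : 0 ≤ ∑ i ∈ s, c i * (a * α i x₀) := Finset.sum_nonneg fun i hi =>
        mul_nonneg (hc i) (mul_nonneg ha₀.le (hx₀ i hi))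
      refine ⟨Function.update c j (∑ i ∈ s, c i * (a * α i x₀) - a * γ x₀),
        fun i => ?_, fun x => ?_⟩
      · by_cases hij : i = j
        · subst hij
          rw [Function.update_self]
          nlinarith
        · simpa [hij] using hc i
      · have hx := hγ x
        simp only [LinearMap.add_apply, LinearMap.smul_apply, smul_eq_mul] at hx
        have hs : ∑ i ∈ s, Function.update c j (∑ i ∈ s, c i * (a * α i x₀) - a * γ x₀) i * α i x
            = ∑ i ∈ s, c i * α i x := Finset.sum_congr rfl fun i hi => by
          rw [Function.update_of_ne (ne_of_mem_of_not_mem hi hj)]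
        rw [Finset.sum_insert hj, hs, Function.update_self, sub_mul, Finset.sum_mul]
        simp only [mul_add, Finset.sum_add_distrib, mul_assoc] at hx ⊢
        linarith

/-- Two elements not separated by rational-valued characters become equal in the torsion-free
quotient of the Grothendieck group. -/
theorem exists_nsmul_add_eq_of_forall_hom_eq {M : Type*} [AddCommMonoid M] {a b : M}
    (h : ∀ χ : M →+ ℚ, χ a = χ b) : ∃ k : ℕ, 0 < k ∧ ∃ s : M, k • a + s = k • b + s := by
  let G := Algebra.GrothendieckAddGroup M
  let ι : M →+ G := Algebra.GrothendieckAddGroup.of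
  let τ := TensorProduct.mk ℤ ℚ G 1
  have hτ : τ (ι a - ι b) = 0 := by
    refine (Module.forall_dual_apply_eq_zero_iff ℚ _).mp fun φ => ?_
    have := h ((φ.toAddMonoidHom.comp τ.toAddMonoidHom).comp ι)
    rw [map_sub, map_sub, sub_eq_zero]
    exact this
  obtain ⟨n, hn⟩ := (IsLocalizedModule.eq_zero_iff (nonZeroDivisors ℤ) τ).mp hτ
  have hn₀ : (n : ℤ) ≠ 0 := nonZeroDivisors.coe_ne_zero n
  have hk : (n : ℤ).natAbs • (ι a - ι b) = 0 := by
    have hn' : (n : ℤ) • (ι a - ι b) = 0 := hn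
    rcases Int.natAbs_eq (n : ℤ) with h | h <;> rw [h] at hn' <;> simpa using hn'
  refine ⟨(n : ℤ).natAbs, Int.natAbs_pos.mpr hn₀, ?_⟩
  rw [smul_sub, sub_eq_zero, ← map_nsmul, ← map_nsmul] at hk
  obtain ⟨c, hc⟩ := (AddSubmonoid.LocalizationMap.eq_iff_exists
    (AddLocalization.addMonoidOf (⊤ : AddSubmonoid M))).mp hk
  exact ⟨c, by rw [add_comm _ (c : M), add_comm _ (c : M)]; exact hc⟩

/-- Finitely many nonnegative rationals have a common denominator. -/
theorem exists_common_denominator {ι : Type*} (s : Finset ι) (c : ι → ℚ) (hc : ∀ i ∈ s, 0 ≤ c i) :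
    ∃ N : ℕ, 0 < N ∧ ∀ i ∈ s, ∃ n : ℕ, (n : ℚ) = N * c i := by
  refine ⟨∏ i ∈ s, (c i).den, Finset.prod_pos fun i _ => (c i).den_pos, fun i hi => ?_⟩
  obtain ⟨m, hm⟩ := Finset.dvd_prod_of_mem (fun i => (c i).den) hi
  obtain ⟨a, ha⟩ := Int.eq_ofNat_of_zero_le (Rat.num_nonneg.mpr (hc i hi))
  refine ⟨m * a, ?_⟩
  have h := Rat.mul_den_eq_num (c i)
  rw [ha] at h
  rw [hm]
  push_cast at h ⊢
  linear_combination -(m : ℚ) * h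

/-- A rational character that is nonnegative on generators has a natural-valued multiple. -/
theorem exists_nat_hom_eq_mul {M : Type*} [AddCommMonoid M] {T : Finset M}
    (hT : AddSubmonoid.closure (T : Set M) = ⊤) (χ : M →+ ℚ) (hχ : ∀ t ∈ T, 0 ≤ χ t) :
    ∃ N : ℕ, 0 < N ∧ ∃ ψ : M →+ ℕ, ∀ x, (ψ x : ℚ) = N * χ x := by
  obtain ⟨N, hN, hNT⟩ := exists_common_denominator T χ hχ
  have hall : ∀ x : M, ∃ n : ℕ, (n : ℚ) = N * χ x := by
    intro x
    have hx : x ∈ AddSubmonoid.closure (T : Set M) := hT ▸ AddSubmonoid.mem_top x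
    induction hx using AddSubmonoid.closure_induction with
    | mem t ht => exact hNT t ht
    | zero => exact ⟨0, by simp⟩
    | add y z _ _ ihy ihz =>
      obtain ⟨n, hn⟩ := ihy
      obtain ⟨m, hm⟩ := ihz
      exact ⟨n + m, by push_cast; rw [hn, hm, map_add, mul_add]⟩
  choose ψ hψ using hall
  refine ⟨N, hN, ⟨⟨ψ, ?_⟩, fun x y => ?_⟩, hψ⟩
  · have := hψ 0
    simpa using this
  · have h : (ψ (x + y) : ℚ) = ψ x + ψ y := by rw [hψ, hψ, hψ, map_add, mul_add]
    exact_mod_cast h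

/-- Finitely many stable identities `k • a t + s = k • b t + s` hold with common `k` and `s`. -/
theorem exists_uniform_nsmul_add_eq {M : Type*} [AddCommMonoid M] (T : Finset M) (a b : M → M)
    (h : ∀ t ∈ T, ∃ k : ℕ, 0 < k ∧ ∃ s : M, k • a t + s = k • b t + s) :
    ∃ k : ℕ, 0 < k ∧ ∃ s : M, ∀ t ∈ T, k • a t + s = k • b t + s := by
  classical
  induction T using Finset.induction_on with
  | empty => exact ⟨1, one_pos, 0, by simp⟩
  | insert t T _ ih =>
    obtain ⟨k, hk, s, hs⟩ := ih fun u hu => h u (Finset.mem_insert_of_mem hu)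
    obtain ⟨l, hl, r, hr⟩ := h t (Finset.mem_insert_self _ _)
    refine ⟨k * l, Nat.mul_pos hk hl, l • s + k • r, fun u hu => ?_⟩
    rcases Finset.mem_insert.mp hu with rfl | hu
    · rw [mul_smul, mul_smul, add_comm (l • s), ← add_assoc, ← add_assoc, ← smul_add, ← smul_add,
        hr]
    · rw [mul_comm, mul_smul, mul_smul, ← add_assoc, ← add_assoc, ← smul_add, ← smul_add, hs u hu]

/-- `y` divides a multiple of `w` in an additive commutative monoid. -/
def DvdMultiple {M : Type*} [AddCommMonoid M] (y w : M) : Prop :=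
  ∃ (n : ℕ) (v : M), n • w = y + v

namespace DvdMultiple

variable {M : Type*} [AddCommMonoid M]

theorem refl (y : M) : DvdMultiple y y := ⟨1, 0, by simp⟩

theorem of_add_left {y z w : M} (h : DvdMultiple (y + z) w) : DvdMultiple y w := by
  obtain ⟨n, v, h⟩ := h
  exact ⟨n, z + v, by rw [h, add_assoc]⟩

theorem add {y z w : M} (hy : DvdMultiple y w) (hz : DvdMultiple z w) :
    DvdMultiple (y + z) w := by
  obtain ⟨n, v, hn⟩ := hy
  obtain ⟨m, u, hm⟩ := hz
  exact ⟨n + m, v + u, by rw [add_smul, hn, hm, add_add_add_comm]⟩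

theorem of_forall_generators {T : Finset M} (hT : AddSubmonoid.closure (T : Set M) = ⊤) {w w' : M}
    (h : ∀ t ∈ T, DvdMultiple t w → DvdMultiple t w') (y : M) :
    DvdMultiple y w → DvdMultiple y w' := by
  have hy : y ∈ AddSubmonoid.closure (T : Set M) := hT ▸ AddSubmonoid.mem_top y
  induction hy using AddSubmonoid.closure_induction with
  | mem t ht => exact h t ht
  | zero => exact fun _ => ⟨0, 0, by simp⟩
  | add y z _ _ ihy ihz =>
    intro hyz
    exact (ihy hyz.of_add_left).add (ihz (add_comm y z ▸ hyz).of_add_left)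

/-- An element absorbed by one of its divisors up to multiples has an idempotent multiple. -/
theorem exists_idempotent [Subsingleton (AddUnits M)] {s w : M} (hs : s ≠ 0) (hsw : s + w = s)
    (h : DvdMultiple s w) : ∃ c : M, c ≠ 0 ∧ c + c = c := by
  obtain ⟨n, v, hn⟩ := h
  have absorb : ∀ m : ℕ, n • w + m • w = n • w := by
    intro m
    induction m with
    | zero => simp
    | succ m ih =>
      rw [succ_nsmul, ← add_assoc, ih, hn, add_right_comm, hsw]
  refine ⟨n • w, fun h₀ => hs ?_, absorb n⟩
  exact (add_eq_zero.mp (hn.symm.trans h₀)).1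

end DvdMultiple

section Endomorphisms

variable {M : Type*} [AddCommMonoid M]

/-- The homomorphism `x ↦ ψ x • a`. -/
def smulRightHom (ψ : M →+ ℕ) (a : M) : M →+ M where
  toFun x := ψ x • a
  map_zero' := by simp
  map_add' x y := by rw [map_add, add_smul]

/-- A homomorphism is proper if only zero is sent to zero. -/
def IsProperHom {N : Type*} [AddCommMonoid N] (f : M →+ N) : Prop := ∀ x, f x = 0 → x = 0

theorem IsProperHom.id : IsProperHom (AddMonoidHom.id M) := fun _ h => h

theorem IsProperHom.comp {f g : M →+ M} (hf : IsProperHom f) (hg : IsProperHom g) :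
    IsProperHom (f.comp g) := fun x h => hg x (hf _ h)

/-- The map `e` exhibits the proper endomorphisms of `M` as a free commutative semigroup. -/
structure IsFreeOnProper {X : Type*} (e : (M →+ M) → Multiset X) : Prop where
  add : ∀ f g, IsProperHom f → IsProperHom g → e (f + g) = e f + e g
  inj : ∀ f g, IsProperHom f → IsProperHom g → e f = e g → f = g
  ne_zero : ∀ f, IsProperHom f → e f ≠ 0
  surj : ∀ m, m ≠ 0 → ∃ f, IsProperHom f ∧ e f = m

theorem IsFreeOnProper.exists_ne_zero {X : Type*} {e : (M →+ M) → Multiset X}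
    (he : IsFreeOnProper e) : ∃ x : M, x ≠ 0 := by
  by_contra! h
  have hid : AddMonoidHom.id M + AddMonoidHom.id M = AddMonoidHom.id M :=
    AddMonoidHom.ext fun x => (h _).trans (h _).symm
  have := he.add _ _ IsProperHom.id IsProperHom.id
  rw [hid, left_eq_add] at this
  exact he.ne_zero _ IsProperHom.id this

variable [Subsingleton (AddUnits M)]

theorem IsProperHom.add {f : M →+ M} (hf : IsProperHom f) (g : M →+ M) :
    IsProperHom (f + g) := fun x h => hf x (add_eq_zero.mp h).1

theorem IsProperHom.succ_nsmul {f : M →+ M} (hf : IsProperHom f) (n : ℕ) :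
    IsProperHom ((n + 1) • f) := by
  rw [_root_.succ_nsmul']
  exact hf.add _

/-- If a proper endomorphism moves a nonzero element to one that it absorbs, a finitely generated
monoid contains a nonzero idempotent. -/
theorem exists_idempotent_of_add_apply_eq_self {T : Finset M}
    (hT : AddSubmonoid.closure (T : Set M) = ⊤) {δ : M →+ M} (hδ : IsProperHom δ) {x : M}
    (hx : x ≠ 0) (hxδ : x + δ x = x) : ∃ c : M, c ≠ 0 ∧ c + c = c := by
  classical
  let w : ℕ → M := fun k => δ^[k] x
  have hw : ∀ k, w (k + 1) = δ (w k) := fun k => Function.iterate_succ_apply' _ _ _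
  have hw₀ : ∀ k, w k ≠ 0 := by
    intro k
    induction k with
    | zero => exact hx
    | succ k ih => rw [hw]; exact fun h => ih (hδ _ h)
  have habs : ∀ k, w k + w (k + 1) = w k := by
    intro k
    induction k with
    | zero => exact hxδ
    | succ k ih =>
      have := congrArg δ ih
      rwa [map_add, ← hw, ← hw] at this
  let supp : ℕ → Finset M := fun k => T.filter fun t => DvdMultiple t (w k)
  have hsub : ∀ k, supp (k + 1) ⊆ supp k := by
    intro k t ht
    obtain ⟨htT, n, v, hn⟩ := Finset.mem_filter.mp ht
    refine Finset.mem_filter.mpr ⟨htT, n, v + n • w k, ?_⟩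
    rw [← add_assoc, ← hn, ← smul_add, add_comm, habs]
  obtain ⟨k, hk⟩ : ∃ k, supp k ⊆ supp (k + 1) := by
    by_contra! hne
    exact not_strictAnti_of_wellFoundedLT supp
      (strictAnti_nat_of_succ_lt fun k => ⟨hsub k, hne k⟩)
  refine DvdMultiple.exists_idempotent (hw₀ k) (habs k) ?_
  exact DvdMultiple.of_forall_generators hT
    (fun t ht h => (Finset.mem_filter.mp (hk (Finset.mem_filter.mpr ⟨ht, h⟩))).2) _ (.refl _)

namespace IsFreeOnProper

variable {X : Type*} {e : (M →+ M) → Multiset X}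

theorem succ_nsmul (he : IsFreeOnProper e) {f : M →+ M} (hf : IsProperHom f) (n : ℕ) :
    e ((n + 1) • f) = (n + 1) • e f := by
  induction n with
  | zero => simp
  | succ n ih =>
    rw [_root_.succ_nsmul, he.add _ _ (hf.succ_nsmul n) hf, ih, ← _root_.succ_nsmul]

theorem eq_zero_of_add_self_eq (he : IsFreeOnProper e) {c : M} (hc : c + c = c) : c = 0 := by
  classical
  by_contra hc₀
  let f : M →+ M :=
    { toFun := fun x => if x = 0 then 0 else c
      map_zero' := by simp
      map_add' := fun x y => by
        by_cases hx : x = 0 <;> by_cases hy : y = 0 <;> simp [add_eq_zero, hx, hy, hc] }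
  have hf : IsProperHom f := fun x hx => by
    by_contra hx₀
    exact hc₀ (by simpa [f, hx₀] using hx)
  have hff : f + f = f := AddMonoidHom.ext fun x => by
    by_cases hx : x = 0 <;> simp [f, hx, hc]
  have := he.add f f hf hf
  rw [hff, left_eq_add] at this
  exact he.ne_zero f hf this

/-- Adding a possibly improper endomorphism to the identity amounts to adding zero or a
proper one, because `id + n • D` is an arithmetic progression in the free semigroup. -/
theorem exists_proper_id_add_eq (he : IsFreeOnProper e) (D : M →+ M) : ∃ δ : M →+ M,
    (δ = 0 ∨ IsProperHom δ) ∧ AddMonoidHom.id M + δ = AddMonoidHom.id M + D := by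
  classical
  have hI := IsProperHom.id (M := M)
  have hprog : ∀ n : ℕ, n • e (.id M + D) + e (.id M) = e (.id M + n • D) + n • e (.id M) := by
    intro n
    induction n with
    | zero => simp
    | succ n ih =>
      have hstep : e (.id M + n • D) + e (.id M + D) = e (.id M + (n + 1) • D) + e (.id M) := by
        rw [← he.add _ _ (hI.add _) (hI.add _), ← he.add _ _ (hI.add _) hI]
        congr 1
        rw [_root_.succ_nsmul, ← add_assoc, ← add_assoc, add_right_comm]
      rw [_root_.succ_nsmul, add_right_comm, ih, add_right_comm, hstep, _root_.succ_nsmul _ n,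
        _root_.succ_nsmul _ n, add_right_comm, add_assoc]
  have hle : e (.id M) ≤ e (.id M + D) := by
    refine Multiset.le_iff_count.mpr fun q => ?_
    have h := congrArg (Multiset.count q) (hprog (Multiset.count q (e (.id M)) + 1))
    simp only [Multiset.count_add, Multiset.count_nsmul] at h
    by_contra! hlt
    nlinarith
  obtain ⟨d, hd⟩ := Multiset.le_iff_exists_add.mp hle
  by_cases hd₀ : d = 0
  · refine ⟨0, Or.inl rfl, ?_⟩
    rw [hd₀, add_zero] at hd
    rw [add_zero]
    exact (he.inj _ _ (hI.add D) hI hd).symm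
  · obtain ⟨δ, hδ, rfl⟩ := he.surj d hd₀
    refine ⟨δ, Or.inr hδ, ?_⟩
    exact he.inj _ _ (hI.add δ) (hI.add D) (by rw [he.add _ _ hI hδ, hd])

variable {T : Finset M}

theorem nat_hom_eq_zero (he : IsFreeOnProper e)
    (hT : AddSubmonoid.closure (T : Set M) = ⊤)
    {ψ : M →+ ℕ} {x : M} (hx : x ≠ 0) (hψx : ψ x = 0) : ψ = 0 := by
  by_contra hψ
  obtain ⟨a, ha⟩ := DFunLike.ne_iff.mp hψ
  obtain ⟨δ, hδ | hδ, h⟩ := he.exists_proper_id_add_eq (smulRightHom ψ a)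
  · have h' := congrArg ψ (DFunLike.congr_fun h a)
    simp only [hδ, smulRightHom, AddMonoidHom.add_apply, AddMonoidHom.id_apply,
      AddMonoidHom.zero_apply, AddMonoidHom.coe_mk, ZeroHom.coe_mk, map_add, map_nsmul,
      map_zero, smul_eq_mul] at h'
    have : ψ a * ψ a = 0 := by omega
    exact ha (by simpa using this)
  · have h' := DFunLike.congr_fun h x
    simp only [smulRightHom, AddMonoidHom.add_apply, AddMonoidHom.id_apply,
      AddMonoidHom.coe_mk, ZeroHom.coe_mk, hψx, zero_smul, add_zero] at h'
    obtain ⟨c, hc₀, hc⟩ := exists_idempotent_of_add_apply_eq_self hT hδ hx h'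
    exact hc₀ (he.eq_zero_of_add_self_eq hc)

theorem exists_nat_hom_ne_zero (he : IsFreeOnProper e)
    (hT : AddSubmonoid.closure (T : Set M) = ⊤) : ∃ ψ : M →+ ℕ, ψ ≠ 0 := by
  classical
  by_contra! hall
  let ev : M → (M →+ ℚ) →ₗ[ℚ] ℚ := fun x =>
    { toFun := fun χ => χ x
      map_add' := fun _ _ => rfl
      map_smul' := fun _ _ => rfl }
  have hvanish : ∀ χ : M →+ ℚ, (∀ t ∈ T, 0 ≤ χ t) → χ = 0 := by
    intro χ hχ
    obtain ⟨N, hN, ψ, hψ⟩ := exists_nat_hom_eq_mul hT χ hχ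
    refine AddMonoidHom.ext fun x => ?_
    have := hψ x
    rw [hall ψ] at this
    simpa [hN.ne'] using this
  obtain ⟨c, hc, hcT⟩ := exists_nonneg_combination_of_forall_nonneg T ev (-ev (∑ t ∈ T, t))
    fun χ hχ => by rw [hvanish χ hχ, map_zero]
  obtain ⟨N, hN, hNT⟩ := exists_common_denominator T c fun i _ => hc i
  choose! n hn using hNT
  obtain ⟨k, hk, s, hs⟩ := exists_nsmul_add_eq_of_forall_hom_eq
    (a := N • ∑ t ∈ T, t + ∑ t ∈ T, n t • t) (b := 0) fun χ => by
      have h : -χ (∑ t ∈ T, t) = ∑ t ∈ T, c t * χ t := hcT χ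
      have hsum : ∑ t ∈ T, (n t : ℚ) * χ t = N * ∑ t ∈ T, c t * χ t := by
        rw [Finset.mul_sum]
        exact Finset.sum_congr rfl fun t ht => by rw [hn t ht, mul_assoc]
      rw [map_zero, map_add, map_nsmul, map_sum χ (fun t => n t • t)]
      simp only [map_nsmul, nsmul_eq_mul]
      rw [hsum, ← h]
      ring
  obtain ⟨k, rfl⟩ := Nat.exists_eq_succ_of_ne_zero hk.ne'
  obtain ⟨N, rfl⟩ := Nat.exists_eq_succ_of_ne_zero hN.ne'
  rw [smul_zero, zero_add, add_comm] at hs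
  set w := k.succ • (N.succ • ∑ t ∈ T, t + ∑ t ∈ T, n t • t) with hw
  have hdvd : ∀ y, DvdMultiple y w := fun y => by
    refine DvdMultiple.of_forall_generators hT (fun t ht _ => ⟨1, ?_⟩) y (.refl y)
    refine ⟨∑ u ∈ T.erase t, u + (N • ∑ t ∈ T, t + ∑ t ∈ T, n t • t +
      k • (N.succ • ∑ t ∈ T, t + ∑ t ∈ T, n t • t)), ?_⟩
    rw [hw, one_smul, ← add_assoc t, Finset.add_sum_erase T (fun u => u) ht, Nat.succ_eq_add_one,
      Nat.succ_eq_add_one, _root_.succ_nsmul' _ k, _root_.succ_nsmul' _ N]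
    abel
  by_cases hs₀ : s = 0
  · obtain ⟨x, hx⟩ := he.exists_ne_zero
    obtain ⟨m, v, hv⟩ := hdvd x
    rw [hs₀, zero_add] at hs
    rw [hs, smul_zero] at hv
    exact hx (add_eq_zero.mp hv.symm).1
  · obtain ⟨c, hc₀, hc⟩ := DvdMultiple.exists_idempotent hs₀ hs (hdvd s)
    exact hc₀ (he.eq_zero_of_add_self_eq hc)

theorem exists_proportional (he : IsFreeOnProper e)
    (hT : AddSubmonoid.closure (T : Set M) = ⊤)
    {φ : M →+ ℕ} (hφ : IsProperHom φ) (χ : M →+ ℚ) :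
    ∃ c : ℚ, ∀ x, χ x = c * φ x := by
  classical
  have hne : (T.filter (· ≠ 0)).Nonempty := by
    obtain ⟨x, hx⟩ := he.exists_ne_zero
    by_contra hemp
    rw [Finset.not_nonempty_iff_eq_empty, Finset.filter_eq_empty_iff] at hemp
    have hbot : AddSubmonoid.closure (T : Set M) ≤ ⊥ :=
      AddSubmonoid.closure_le.mpr fun t ht => by simpa using hemp ht
    exact hx (by simpa using hbot (hT ▸ AddSubmonoid.mem_top x))
  obtain ⟨t₀, ht₀, hmin⟩ := Finset.exists_min_image _ (fun t => χ t / φ t) hne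
  have hpos : ∀ x : M, x ≠ 0 → (0 : ℚ) < φ x := fun x hx =>
    Nat.cast_pos.mpr (Nat.pos_of_ne_zero fun h => hx (hφ x h))
  have ht₀' := (Finset.mem_filter.mp ht₀).2
  let c : ℚ := χ t₀ / φ t₀
  let ρ : M →+ ℚ := χ - c • (Nat.castAddMonoidHom ℚ).comp φ
  have hρ : ∀ x, ρ x = χ x - c * φ x := fun x => rfl
  obtain ⟨N, hN, ψ, hψ⟩ := exists_nat_hom_eq_mul hT ρ fun t ht => by
    by_cases ht' : t = 0
    · simp [ht']
    · have := hmin t (Finset.mem_filter.mpr ⟨ht, ht'⟩)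
      rw [le_div_iff₀ (hpos t ht')] at this
      rw [hρ]
      exact sub_nonneg.mpr this
  have hψ₀ : ψ = 0 := he.nat_hom_eq_zero hT ht₀' (by
    have h := hψ t₀
    rw [hρ, div_mul_cancel₀ _ (hpos t₀ ht₀').ne', sub_self, mul_zero] at h
    exact_mod_cast h)
  refine ⟨c, fun x => ?_⟩
  have h := hψ x
  rw [hψ₀, hρ, AddMonoidHom.zero_apply, Nat.cast_zero, eq_comm] at h
  simpa [hN.ne', sub_eq_zero] using h


/-- The identity is a free generator: a decomposition `id = p + g` with `p` a generator would
decompose `p = p ∘ p + p ∘ g`. -/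
theorem exists_apply_id_eq_singleton (he : IsFreeOnProper e) : ∃ q, e (.id M) = {q} := by
  have hI := IsProperHom.id (M := M)
  obtain ⟨q, hq⟩ := Multiset.exists_mem_of_ne_zero (he.ne_zero _ hI)
  obtain ⟨r, hr⟩ := Multiset.exists_cons_of_mem hq
  refine ⟨q, ?_⟩
  by_cases hr₀ : r = 0
  · rw [hr, hr₀]
    rfl
  · exfalso
    obtain ⟨g, hg, rfl⟩ := he.surj r hr₀
    obtain ⟨p, hp, hpq⟩ := he.surj {q} (Multiset.singleton_ne_zero q)
    have hid : p + g = .id M := he.inj _ _ (hp.add g) hI (by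
      rw [he.add p g hp hg, hr, hpq, Multiset.singleton_add])
    have hpp : p = p.comp p + p.comp g := by
      rw [← AddMonoidHom.comp_add, hid, AddMonoidHom.comp_id]
    have hcard := congrArg (fun f => Multiset.card (e f)) hpp
    simp only [he.add _ _ (hp.comp hp) (hp.comp hg), Multiset.card_add, hpq,
      Multiset.card_singleton] at hcard
    have h₁ := Multiset.card_pos.mpr (he.ne_zero _ (hp.comp hp))
    have h₂ := Multiset.card_pos.mpr (he.ne_zero _ (hp.comp hg))
    omega

theorem exists_succ_nsmul_eq_succ_nsmul_id (he : IsFreeOnProper e)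
    (hT : AddSubmonoid.closure (T : Set M) = ⊤)
    {p : M →+ M} (hp : IsProperHom p) :
    ∃ m n : ℕ, (m + 1) • p = (n + 1) • AddMonoidHom.id M := by
  have hI := IsProperHom.id (M := M)
  obtain ⟨φ, hφ₀⟩ := he.exists_nat_hom_ne_zero hT
  have hφ : IsProperHom φ := fun x hx => by
    by_contra hx₀
    exact hφ₀ (he.nat_hom_eq_zero hT hx₀ hx)
  obtain ⟨x₀, hx₀⟩ := he.exists_ne_zero
  have hm : φ x₀ ≠ 0 := fun h => hx₀ (hφ _ h)
  have hn : φ (p x₀) ≠ 0 := fun h => hx₀ (hp _ (hφ _ h))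
  obtain ⟨c, hc⟩ := he.exists_proportional hT hφ (((Nat.castAddMonoidHom ℚ).comp φ).comp p)
  have hφp : ∀ x, (φ (p x) : ℚ) = c * φ x := hc
  have hsep : ∀ x, ∃ k : ℕ, 0 < k ∧ ∃ s : M, k • φ x₀ • p x + s = k • φ (p x₀) • x + s := by
    refine fun x => exists_nsmul_add_eq_of_forall_hom_eq fun χ => ?_
    obtain ⟨d, hd⟩ := he.exists_proportional hT hφ χ
    rw [map_nsmul, map_nsmul, hd, hd, nsmul_eq_mul, nsmul_eq_mul, hφp, hφp]
    ring
  obtain ⟨k, hk, s, hs⟩ := exists_uniform_nsmul_add_eq T (fun x => φ x₀ • p x)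
    (fun x => φ (p x₀) • x) fun t _ => hsep t
  obtain ⟨m, hm'⟩ := Nat.exists_eq_succ_of_ne_zero (Nat.mul_pos hk (Nat.pos_of_ne_zero hm)).ne'
  obtain ⟨n, hn'⟩ := Nat.exists_eq_succ_of_ne_zero (Nat.mul_pos hk (Nat.pos_of_ne_zero hn)).ne'
  have hsum : (m + 1) • p + (.id M + smulRightHom φ s)
      = (n + 1) • AddMonoidHom.id M + (.id M + smulRightHom φ s) := by
    refine AddMonoidHom.eq_of_eqOn_denseM hT fun t ht => ?_
    have hφt : (m + 1) • p t + φ t • s = (n + 1) • t + φ t • s := by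
      by_cases ht₀ : t = 0
      · simp [ht₀]
      · obtain ⟨j, hj⟩ := Nat.exists_eq_succ_of_ne_zero fun h => ht₀ (hφ _ h)
        have h := hs t ht
        rw [← mul_smul, ← mul_smul, hm', hn'] at h
        rw [hj, Nat.succ_eq_add_one, _root_.succ_nsmul' s, ← add_assoc,
          ← add_assoc, show (m + 1) • p t + s = (n + 1) • t + s from h]
    change (m + 1) • p t + (t + φ t • s) = (n + 1) • t + (t + φ t • s)
    rw [add_left_comm, hφt, add_left_comm]
  refine ⟨m, n, he.inj _ _ (hp.succ_nsmul m) (hI.succ_nsmul n) ?_⟩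
  have h := congrArg e hsum
  rwa [he.add _ _ (hp.succ_nsmul m) (hI.add _), he.add _ _ (hI.succ_nsmul n) (hI.add _),
    add_left_inj] at h

theorem exists_eq_succ_nsmul_id (he : IsFreeOnProper e)
    (hT : AddSubmonoid.closure (T : Set M) = ⊤)
    {p : M →+ M} (hp : IsProperHom p) :
    ∃ n : ℕ, p = (n + 1) • AddMonoidHom.id M := by
  have hI := IsProperHom.id (M := M)
  obtain ⟨m, n, h⟩ := he.exists_succ_nsmul_eq_succ_nsmul_id hT hp
  obtain ⟨q, hq⟩ := he.exists_apply_id_eq_singleton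
  have h' := congrArg e h
  rw [he.succ_nsmul hp, he.succ_nsmul hI, hq, Multiset.nsmul_singleton] at h'
  have hmem : ∀ r ∈ e p, r = q := fun r hr => Multiset.eq_of_mem_replicate
    (h' ▸ Multiset.mem_nsmul.mpr ⟨m.succ_ne_zero, hr⟩)
  obtain ⟨i, hi⟩ := Nat.exists_eq_succ_of_ne_zero
    (Multiset.card_pos.mpr (he.ne_zero p hp)).ne'
  refine ⟨i, he.inj _ _ hp (hI.succ_nsmul i) ?_⟩
  rw [he.succ_nsmul hI, hq, Multiset.nsmul_singleton]
  exact Multiset.eq_replicate.mpr ⟨hi, hmem⟩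

end IsFreeOnProper

end Endomorphisms

namespace SemigroupEnd

section WithOne

variable {S : Type*}

/-- The inclusion of `S` into the additive monoid obtained by adjoining a zero. -/
def toAdd (x : S) : Additive (WithOne S) := Additive.ofMul (x : WithOne S)

theorem toAdd_injective : Function.Injective (toAdd : S → Additive (WithOne S)) :=
  Additive.ofMul.injective.comp WithOne.coe_injective

theorem toAdd_ne_zero (x : S) : toAdd x ≠ 0 := WithOne.coe_ne_one

theorem eq_zero_or_eq_toAdd (y : Additive (WithOne S)) : y = 0 ∨ ∃ x : S, y = toAdd x := by
  rcases Option.eq_none_or_eq_some y with h | ⟨x, h⟩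
  · exact Or.inl h
  · exact Or.inr ⟨x, h⟩

end WithOne

variable {S : Type*} [CommSemigroup S]

theorem toAdd_mul (x y : S) : toAdd (x * y) = toAdd x + toAdd y := rfl

theorem toAdd_spow (x : S) (n : ℕ) : toAdd (spow x n) = (n + 1) • toAdd x := by
  induction n with
  | zero => simp [spow]
  | succ n ih => rw [spow, toAdd_mul, ih, succ_nsmul _ (n + 1)]

instance : Subsingleton (AddUnits (Additive (WithOne S))) where
  allEq u v := by
    have h : ∀ u : AddUnits (Additive (WithOne S)), (u : Additive (WithOne S)) = 0 := fun u => by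
      rcases eq_zero_or_eq_toAdd (u : Additive (WithOne S)) with hu | ⟨x, hx⟩
      · exact hu
      · have huv := u.val_neg
        rcases eq_zero_or_eq_toAdd u.neg with hv | ⟨y, hy⟩
        · rwa [hv, add_zero] at huv
        · rw [hx, hy, ← toAdd_mul] at huv
          exact absurd huv (toAdd_ne_zero _)
    exact AddUnits.ext ((h u).trans (h v).symm)

theorem closure_image_toAdd [DecidableEq (Additive (WithOne S))] {F : Finset S}
    (hF : Subsemigroup.closure (F : Set S) = ⊤) :
    AddSubmonoid.closure ((F.image toAdd : Finset _) : Set (Additive (WithOne S))) = ⊤ := by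
  refine (AddSubmonoid.eq_top_iff' _).mpr fun y => ?_
  rcases eq_zero_or_eq_toAdd y with rfl | ⟨x, rfl⟩
  · exact zero_mem _
  · have hx : x ∈ Subsemigroup.closure (F : Set S) := hF ▸ Subsemigroup.mem_top x
    induction hx using Subsemigroup.closure_induction with
    | mem t ht => exact AddSubmonoid.subset_closure (Finset.mem_image_of_mem _ ht)
    | mul a b _ _ iha ihb => exact toAdd_mul a b ▸ add_mem iha ihb

/-- The extension of a semigroup endomorphism to the monoid with an adjoined zero. -/
def toHom (f : SemigroupEnd S) : Additive (WithOne S) →+ Additive (WithOne S) :=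
  MonoidHom.toAdditive (WithOne.mapMulHom ⟨f.1, f.2⟩)

theorem toHom_toAdd (f : SemigroupEnd S) (x : S) : f.toHom (toAdd x) = toAdd (f.1 x) := rfl

theorem hom_ext {f g : Additive (WithOne S) →+ Additive (WithOne S)}
    (h : ∀ x : S, f (toAdd x) = g (toAdd x)) : f = g := by
  refine AddMonoidHom.ext fun y => ?_
  rcases eq_zero_or_eq_toAdd y with rfl | ⟨x, rfl⟩
  · rw [map_zero, map_zero]
  · exact h x

theorem toHom_injective : Function.Injective (toHom (S := S)) := fun _ _ h =>
  Subtype.ext (funext fun x => toAdd_injective (DFunLike.congr_fun h (toAdd x)))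

theorem toHom_mul (f g : SemigroupEnd S) : (f * g).toHom = f.toHom + g.toHom :=
  hom_ext fun _ => rfl

theorem isProperHom_toHom (f : SemigroupEnd S) : IsProperHom f.toHom := fun y hy => by
  rcases eq_zero_or_eq_toAdd y with rfl | ⟨x, rfl⟩
  · rfl
  · exact absurd hy (toAdd_ne_zero _)

theorem exists_toHom_eq {g : Additive (WithOne S) →+ Additive (WithOne S)} (hg : IsProperHom g) :
    ∃ f : SemigroupEnd S, f.toHom = g := by
  have h : ∀ x : S, ∃ y : S, g (toAdd x) = toAdd y := fun x =>
    (eq_zero_or_eq_toAdd _).resolve_left fun h => toAdd_ne_zero x (hg _ h)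
  choose f hf using h
  refine ⟨⟨f, fun x y => toAdd_injective ?_⟩, hom_ext fun x => (hf x).symm⟩
  rw [← hf, toAdd_mul, map_add, hf, hf, toAdd_mul]

theorem isFreeOnProper_extend {X : Type*} {e : SemigroupEnd S → FreeCommSemigroup X}
    (he : Function.Bijective e) (hmul : ∀ f g : SemigroupEnd S, e (f * g) = e f * e g) :
    IsFreeOnProper (Function.extend toHom (fun f => (e f).1) 0) where
  add f g hf hg := by
    obtain ⟨f, rfl⟩ := exists_toHom_eq hf
    obtain ⟨g, rfl⟩ := exists_toHom_eq hg
    rw [← toHom_mul]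
    simp only [toHom_injective.extend_apply, hmul]
    rfl
  inj f g hf hg h := by
    obtain ⟨f, rfl⟩ := exists_toHom_eq hf
    obtain ⟨g, rfl⟩ := exists_toHom_eq hg
    simp only [toHom_injective.extend_apply] at h
    rw [he.1 (Subtype.ext h)]
  ne_zero f hf := by
    obtain ⟨f, rfl⟩ := exists_toHom_eq hf
    rw [toHom_injective.extend_apply]
    exact (e f).2
  surj m hm := by
    obtain ⟨f, hf⟩ := he.2 ⟨m, hm⟩
    exact ⟨f.toHom, f.isProperHom_toHom, by rw [toHom_injective.extend_apply, hf]⟩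

theorem spow_mul_spow (x : S) (m n : ℕ) : spow x m * spow x n = spow x (m + n + 1) :=
  toAdd_injective (by rw [toAdd_mul, toAdd_spow, toAdd_spow, toAdd_spow, ← add_smul]; congr 1; ring)

theorem mul_spow (x y : S) (n : ℕ) : spow (x * y) n = spow x n * spow y n :=
  toAdd_injective (by simp only [toAdd_mul, toAdd_spow, smul_add])

end SemigroupEnd

open SemigroupEnd in
/-- **Borisov.** For a finitely generated commutative semigroup `S`, the
semigroup of endomorphisms of `S` under pointwise multiplication is a free
commutative semigroup (on some set) if and only if it is an infinite monogenic
semigroup generated by the identity endomorphism, i.e. every endomorphism is a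
power function `x ↦ xⁿ` and the power functions for distinct exponents are
pairwise distinct. -/
theorem endomorphism_semigroup_free_comm_iff_monogenic
    {S : Type*} [CommSemigroup S]
    (hfg : ∃ F : Finset S, Subsemigroup.closure (F : Set S) = ⊤) :
    (∃ (X : Type) (e : SemigroupEnd S → FreeCommSemigroup X),
        Function.Bijective e ∧ ∀ f g : SemigroupEnd S, e (f * g) = e f * e g) ↔
    ((∀ f : SemigroupEnd S, ∃ n : ℕ, ∀ x : S, f.1 x = spow x n) ∧
      ∀ m n : ℕ, (∀ x : S, spow x m = spow x n) → m = n) := by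
  constructor
  · rintro ⟨X, e, he, hmul⟩
    classical
    obtain ⟨F, hF⟩ := hfg
    have hfree := isFreeOnProper_extend he hmul
    refine ⟨fun f => ?_, fun m n hmn => ?_⟩
    · obtain ⟨n, hn⟩ := hfree.exists_eq_succ_nsmul_id (closure_image_toAdd hF) f.isProperHom_toHom
      refine ⟨n, fun x => toAdd_injective ?_⟩
      rw [toAdd_spow, ← toHom_toAdd, hn]
      rfl
    · obtain ⟨q, hq⟩ := hfree.exists_apply_id_eq_singleton
      have hI := IsProperHom.id (M := Additive (WithOne S))
      have heq : (m + 1) • AddMonoidHom.id (Additive (WithOne S)) = (n + 1) • .id _ :=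
        hom_ext fun x => by
          have := congrArg toAdd (hmn x)
          rwa [toAdd_spow, toAdd_spow] at this
      have h := congrArg (Function.extend toHom (fun f => (e f).1) 0) heq
      rw [hfree.succ_nsmul hI, hfree.succ_nsmul hI, hq] at h
      simpa using congrArg Multiset.card h
  · rintro ⟨hpow, hinj⟩
    choose n hn using hpow
    refine ⟨Unit, fun f => ⟨Multiset.replicate (n f + 1) (), ?_⟩, ⟨fun f g h => ?_, fun m => ?_⟩,
      fun f g => Subtype.ext ?_⟩
    · rw [Multiset.replicate_succ]
      exact Multiset.cons_ne_zero
    · have hcard := congrArg (fun m : FreeCommSemigroup Unit => Multiset.card m.1) h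
      simp only [Multiset.card_replicate, add_left_inj] at hcard
      exact Subtype.ext (funext fun x => by rw [hn f, hn g, hcard])
    · obtain ⟨k, hk⟩ := Nat.exists_eq_succ_of_ne_zero (Multiset.card_pos.mpr m.2).ne'
      let f : SemigroupEnd S := ⟨fun x => spow x k, fun x y => mul_spow x y k⟩
      have hf : n f = k := hinj _ _ fun x => (hn f x).symm
      refine ⟨f, Subtype.ext ?_⟩
      exact (Multiset.eq_replicate.mpr ⟨by rw [hk, hf], fun _ _ => rfl⟩).symm
    · have hfg : n (f * g) = n f + n g + 1 := hinj _ _ fun x => by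
        rw [← hn, ← spow_mul_spow, ← hn, ← hn]
        rfl
      change Multiset.replicate (n (f * g) + 1) () =
        Multiset.replicate (n f + 1) () + Multiset.replicate (n g + 1) ()
      rw [← Multiset.replicate_add, hfg]
      congr 1
      ring
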